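/- arXiv:1708.03128 — 5 statements merged into one kernel-verified Lean document; each statement's English description precedes it below -/
import Mathlib

section
/- Let t₁ ≥ 1, t₂ and l₂ be natural numbers with (l₂ : ℤ) − 1 ≠ (t₂ : ℤ). Then: (a) whenever integers k₁, k₂ and a natural number m satisfy (m − 1 : ℤ) = k₁·t₁ + k₂·t₂ and (m − 1 : ℤ) = k₁·t₁ + k₂·((l₂ : ℤ) − 1), one necessarily has k₂ = 0; and (b) the least natural number m ≥ 2 for which such integers k₁, k₂ exist is m = 1 + t₁. -/
/-- Case 3a(ii): if `t₁ ≥ 1` and `l₂ - 1 ≠ t₂` (in `ℤ`), then (a) any integer solution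
of the system `m - 1 = k₁ t₁ + k₂ t₂`, `m - 1 = k₁ t₁ + k₂ (l₂ - 1)` has `k₂ = 0`, and
(b) the least `m ≥ 2` for which the system is solvable is `m = 1 + t₁`. -/
theorem stmt_4 (t₁ t₂ l₂ : ℕ) (h1 : 1 ≤ t₁) (h : (l₂ : ℤ) - 1 ≠ (t₂ : ℤ)) :
    (∀ (k₁ k₂ : ℤ) (m : ℕ), (m : ℤ) - 1 = k₁ * t₁ + k₂ * t₂ →
        (m : ℤ) - 1 = k₁ * t₁ + k₂ * ((l₂ : ℤ) - 1) → k₂ = 0) ∧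
    IsLeast {m : ℕ | 2 ≤ m ∧ ∃ k₁ k₂ : ℤ, (m : ℤ) - 1 = k₁ * t₁ + k₂ * t₂ ∧
        (m : ℤ) - 1 = k₁ * t₁ + k₂ * ((l₂ : ℤ) - 1)} (1 + t₁) := by
  have key : ∀ (k₁ k₂ : ℤ) (m : ℕ), (m : ℤ) - 1 = k₁ * t₁ + k₂ * t₂ →
      (m : ℤ) - 1 = k₁ * t₁ + k₂ * ((l₂ : ℤ) - 1) → k₂ = 0 := by
    intro k₁ k₂ m ht hl
    have hz : k₂ * ((l₂ : ℤ) - 1 - t₂) = 0 := by linarith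
    exact (mul_eq_zero.mp hz).resolve_right (sub_ne_zero.mpr h)
  refine ⟨key, ⟨by omega, 1, 0, by push_cast; ring, by push_cast; ring⟩, ?_⟩
  rintro m ⟨hm, k₁, k₂, ht, hl⟩
  obtain rfl := key k₁ k₂ m ht hl
  have hdvd : (t₁ : ℤ) ∣ (m : ℤ) - 1 := ⟨k₁, by linarith⟩
  have hle := Int.le_of_dvd (by omega) hdvd
  omega
end

section
/- Let l₁, t₁, l₂, t₂ be natural numbers such that p := (l₁ : ℤ) − 1 − t₁ ≠ 0 and q := (l₂ : ℤ) − 1 − t₂ ≠ 0, and set g = gcd(p, q) and Δ = ((l₁ : ℤ) − 1)·((l₂ : ℤ) − 1) − t₁·t₂. Then g divides Δ, and for every integer c the following are equivalent: (i) there exist integers k₁, k₂ with c = k₁·((l₁ : ℤ) − 1) + k₂·t₂ and c = k₁·t₁ + k₂·((l₂ : ℤ) − 1); (ii) Δ/g divides c. -/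
/-- The solutions of `k₁ p = k₂ q`, for `p = g p'`, `q = g q'` with `g ≠ 0` and `p'`, `q'` coprime,
are the multiples of `(q', p')`. -/
theorem Int.exists_eq_mul_of_mul_eq_mul {g p' q' k₁ k₂ : ℤ} (hg : g ≠ 0) (hp : p' ≠ 0)
    (hco : IsCoprime p' q') (h : k₁ * (g * p') = k₂ * (g * q')) :
    ∃ m, k₁ = m * q' ∧ k₂ = m * p' := by
  have h' : k₁ * p' = k₂ * q' := mul_left_cancel₀ hg (by linear_combination h)
  obtain ⟨m, hm⟩ : p' ∣ k₂ := hco.dvd_of_dvd_mul_right ⟨k₁, by linear_combination -h'⟩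
  refine ⟨m, mul_right_cancel₀ hp ?_, by rw [hm, mul_comm]⟩
  rw [h', hm]
  ring

/-- With `p = l₁ - 1 - t₁ ≠ 0`, `q = l₂ - 1 - t₂ ≠ 0`, `g = gcd(p, q)` and
`Δ = (l₁ - 1)(l₂ - 1) - t₁ t₂`: `g` divides `Δ`, and an integer `c` is realized by the
system `c = k₁ (l₁ - 1) + k₂ t₂ = k₁ t₁ + k₂ (l₂ - 1)` iff `Δ / g` divides `c`. -/
theorem stmt_6 (l₁ t₁ l₂ t₂ : ℕ)
    (hp : (l₁ : ℤ) - 1 - t₁ ≠ 0) (hq : (l₂ : ℤ) - 1 - t₂ ≠ 0) :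
    ((Int.gcd ((l₁ : ℤ) - 1 - t₁) ((l₂ : ℤ) - 1 - t₂) : ℤ) ∣
        (((l₁ : ℤ) - 1) * ((l₂ : ℤ) - 1) - t₁ * t₂)) ∧
    ∀ c : ℤ,
      (∃ k₁ k₂ : ℤ, c = k₁ * ((l₁ : ℤ) - 1) + k₂ * t₂ ∧
          c = k₁ * t₁ + k₂ * ((l₂ : ℤ) - 1)) ↔
      ((((l₁ : ℤ) - 1) * ((l₂ : ℤ) - 1) - t₁ * t₂) /
          (Int.gcd ((l₁ : ℤ) - 1 - t₁) ((l₂ : ℤ) - 1 - t₂) : ℤ)) ∣ c := by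
  set p : ℤ := (l₁ : ℤ) - 1 - t₁ with hpd
  set q : ℤ := (l₂ : ℤ) - 1 - t₂ with hqd
  have hg : (Int.gcd p q : ℤ) ≠ 0 := by
    simp [Int.gcd_eq_zero_iff, hp]
  obtain ⟨p', hp'⟩ := Int.gcd_dvd_left p q
  obtain ⟨q', hq'⟩ := Int.gcd_dvd_right p q
  have hbez := Int.gcd_eq_gcd_ab p q
  have hco : IsCoprime p' q' := by
    refine ⟨Int.gcdA p q, Int.gcdB p q, mul_left_cancel₀ hg ?_⟩
    linear_combination -hbez - Int.gcdA p q * hp' - Int.gcdB p q * hq'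
  have hp0 : p' ≠ 0 := by
    rintro rfl
    exact hp (by simpa using hp')
  generalize (Int.gcd p q : ℤ) = g at *
  have hΔ : ((l₁ : ℤ) - 1) * ((l₂ : ℤ) - 1) - t₁ * t₂ =
      g * (q' * ((l₁ : ℤ) - 1) + p' * t₂) := by
    linear_combination ((l₁ : ℤ) - 1) * (hq' - hqd) + t₂ * (hp' - hpd)
  rw [hΔ, Int.mul_ediv_cancel_left _ hg]
  refine ⟨dvd_mul_right _ _, fun c => ⟨?_, ?_⟩⟩
  · rintro ⟨k₁, k₂, h₁, h₂⟩
    obtain ⟨m, rfl, rfl⟩ := Int.exists_eq_mul_of_mul_eq_mul (k₁ := k₁) (k₂ := k₂) hg hp0 hco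
      (by linear_combination h₂ - h₁ - k₁ * (hp' - hpd) + k₂ * (hq' - hqd))
    exact ⟨m, by linear_combination h₁⟩
  · rintro ⟨m, rfl⟩
    refine ⟨m * q', m * p', by ring, ?_⟩
    linear_combination m * q' * (hp' - hpd) - m * p' * (hq' - hqd)
end

section
/- Let l₁, t₁, l₂, t₂ be natural numbers with (l₁ : ℤ) − 1 ≠ (t₁ : ℤ) and (l₂ : ℤ) − 1 ≠ (t₂ : ℤ), and suppose Δ := ((l₁ : ℤ) − 1)·((l₂ : ℤ) − 1) − t₁·t₂ = 0. Then there is no natural number m ≥ 2 for which there exist integers k₁, k₂ with (m − 1 : ℤ) = k₁·((l₁ : ℤ) − 1) + k₂·t₂ and (m − 1 : ℤ) = k₁·t₁ + k₂·((l₂ : ℤ) − 1). -/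
/-- Case 3b(i): if `l₁ - 1 ≠ t₁`, `l₂ - 1 ≠ t₂` and `Δ = (l₁ - 1)(l₂ - 1) - t₁ t₂ = 0`,
then there is no `m ≥ 2` for which the system `m - 1 = k₁ (l₁ - 1) + k₂ t₂`,
`m - 1 = k₁ t₁ + k₂ (l₂ - 1)` has an integer solution. -/
theorem stmt_7 (l₁ t₁ l₂ t₂ : ℕ)
    (h1 : (l₁ : ℤ) - 1 ≠ (t₁ : ℤ)) (h2 : (l₂ : ℤ) - 1 ≠ (t₂ : ℤ))
    (hΔ : ((l₁ : ℤ) - 1) * ((l₂ : ℤ) - 1) - t₁ * t₂ = 0) :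
    ¬ ∃ m : ℕ, 2 ≤ m ∧ ∃ k₁ k₂ : ℤ,
        (m : ℤ) - 1 = k₁ * ((l₁ : ℤ) - 1) + k₂ * t₂ ∧
        (m : ℤ) - 1 = k₁ * t₁ + k₂ * ((l₂ : ℤ) - 1) := by
  rintro ⟨m, hm, k₁, k₂, e₁, e₂⟩
  have hprod : (((l₂ : ℤ) - 1) - t₂) * ((m : ℤ) - 1) = 0 := by
    linear_combination ((l₂ : ℤ) - 1) * e₁ - (t₂ : ℤ) * e₂ + k₁ * hΔ
  rcases mul_eq_zero.mp hprod with h | h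
  · exact h2 (sub_eq_zero.mp h)
  · omega
end

section
/- Let l₁, t₁, l₂, t₂ be natural numbers with (l₁ : ℤ) − 1 ≠ (t₁ : ℤ) and (l₂ : ℤ) − 1 ≠ (t₂ : ℤ), and suppose Δ := ((l₁ : ℤ) − 1)·((l₂ : ℤ) − 1) − t₁·t₂ ≠ 0. Then the least natural number m ≥ 2 for which there exist integers k₁, k₂ with (m − 1 : ℤ) = k₁·((l₁ : ℤ) − 1) + k₂·t₂ and (m − 1 : ℤ) = k₁·t₁ + k₂·((l₂ : ℤ) − 1) is m = 1 + |Δ| / gcd(l₁ − 1 − t₁, l₂ − 1 − t₂), where the gcd and the (exact) division are taken in ℤ. -/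
/-- The integers `M` for which `(M, M)` lies in the row lattice of `!![a, b; c, d]` are the
multiples of `(a * d - b * c) / gcd (a - b) (d - c)`. -/
theorem exists_eq_and_eq_iff_div_gcd_dvd {a b c d : ℤ} (hab : a ≠ b) (M : ℤ) :
    (∃ k₁ k₂ : ℤ, M = k₁ * a + k₂ * c ∧ M = k₁ * b + k₂ * d) ↔
      (a * d - b * c) / (Int.gcd (a - b) (d - c) : ℤ) ∣ M := by
  obtain ⟨g, hg⟩ : ∃ g : ℤ, g = Int.gcd (a - b) (d - c) := ⟨_, rfl⟩
  have hg0 : g ≠ 0 := by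
    rw [hg]
    exact_mod_cast Int.gcd_ne_zero_left (sub_ne_zero.2 hab)
  obtain ⟨p, hp⟩ : g ∣ a - b := hg ▸ Int.gcd_dvd_left ..
  obtain ⟨q, hq⟩ : g ∣ d - c := hg ▸ Int.gcd_dvd_right ..
  have hdiv : (a * d - b * c) / g = q * a + p * c := by
    apply Int.ediv_eq_of_eq_mul_right hg0
    linear_combination a * hq + c * hp
  have hp0 : p ≠ 0 := by
    rintro rfl
    exact hab (by linarith)
  have hpq : IsCoprime p q := by
    have hbez := Int.gcd_eq_gcd_ab (a - b) (d - c)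
    rw [← hg] at hbez
    refine ⟨Int.gcdA (a - b) (d - c), Int.gcdB (a - b) (d - c), mul_left_cancel₀ hg0 ?_⟩
    linear_combination -hbez - Int.gcdA (a - b) (d - c) * hp - Int.gcdB (a - b) (d - c) * hq
  rw [← hg, hdiv]
  constructor
  · rintro ⟨k₁, k₂, h₁, h₂⟩
    have hk : k₁ * p = k₂ * q := by
      apply mul_left_cancel₀ hg0
      linear_combination h₂ - h₁ - k₁ * hp + k₂ * hq
    obtain ⟨s, rfl⟩ : p ∣ k₂ := hpq.dvd_of_dvd_mul_right ⟨k₁, by rw [← hk, mul_comm]⟩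
    have hk₁ : k₁ = s * q := by
      apply mul_right_cancel₀ hp0
      linear_combination hk
    exact ⟨s, by rw [h₁, hk₁]; ring⟩
  · rintro ⟨s, rfl⟩
    refine ⟨s * q, s * p, by ring, ?_⟩
    linear_combination s * q * hp - s * p * hq

/-- Case 3b(ii): if `l₁ - 1 ≠ t₁`, `l₂ - 1 ≠ t₂` and `Δ = (l₁ - 1)(l₂ - 1) - t₁ t₂ ≠ 0`,
then the least `m ≥ 2` for which the system `m - 1 = k₁ (l₁ - 1) + k₂ t₂`,
`m - 1 = k₁ t₁ + k₂ (l₂ - 1)` has an integer solution is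
`m = 1 + |Δ| / gcd(l₁ - 1 - t₁, l₂ - 1 - t₂)` (gcd and exact division taken in `ℤ`). -/
theorem stmt_8 (l₁ t₁ l₂ t₂ : ℕ)
    (h1 : (l₁ : ℤ) - 1 ≠ (t₁ : ℤ)) (h2 : (l₂ : ℤ) - 1 ≠ (t₂ : ℤ))
    (hΔ : ((l₁ : ℤ) - 1) * ((l₂ : ℤ) - 1) - t₁ * t₂ ≠ 0) :
    IsLeast {m : ℕ | 2 ≤ m ∧ ∃ k₁ k₂ : ℤ,
        (m : ℤ) - 1 = k₁ * ((l₁ : ℤ) - 1) + k₂ * t₂ ∧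
        (m : ℤ) - 1 = k₁ * t₁ + k₂ * ((l₂ : ℤ) - 1)}
      (1 + (|((l₁ : ℤ) - 1) * ((l₂ : ℤ) - 1) - t₁ * t₂| /
          (Int.gcd ((l₁ : ℤ) - 1 - t₁) ((l₂ : ℤ) - 1 - t₂) : ℤ)).toNat) := by
  have key := exists_eq_and_eq_iff_div_gcd_dvd (c := (t₂ : ℤ)) (d := (l₂ : ℤ) - 1) h1
  obtain ⟨g, hg⟩ : ∃ g : ℤ, g = Int.gcd ((l₁ : ℤ) - 1 - t₁) ((l₂ : ℤ) - 1 - t₂) := ⟨_, rfl⟩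
  have hg0 : 0 < g := by
    rw [hg]
    exact_mod_cast Int.gcd_pos_of_ne_zero_left _ (sub_ne_zero.2 h1)
  have hdvd : g ∣ ((l₁ : ℤ) - 1) * ((l₂ : ℤ) - 1) - t₁ * t₂ := by
    have hp : g ∣ (l₁ : ℤ) - 1 - t₁ := hg ▸ Int.gcd_dvd_left ..
    have hq : g ∣ (l₂ : ℤ) - 1 - t₂ := hg ▸ Int.gcd_dvd_right ..
    exact (dvd_add (hq.mul_left ((l₁ : ℤ) - 1)) (hp.mul_left (t₂ : ℤ))).trans
      (dvd_of_eq (by ring))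
  simp only [key, ← hg]
  obtain ⟨e, he⟩ := hdvd
  have he0 : e ≠ 0 := by
    rintro rfl
    exact hΔ (by rw [he, mul_zero])
  have hpos : 0 < |e| := abs_pos.2 he0
  rw [he, abs_mul, abs_of_pos hg0, Int.mul_ediv_cancel_left _ hg0.ne',
    Int.mul_ediv_cancel_left _ hg0.ne']
  constructor
  · refine ⟨by omega, ?_⟩
    rw [Nat.cast_add, Int.toNat_of_nonneg hpos.le, Nat.cast_one, add_sub_cancel_left]
    exact (dvd_abs e e).2 dvd_rfl
  · rintro m ⟨hm, hem⟩
    have := Int.le_of_dvd (by omega) ((abs_dvd _ _).2 hem)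
    omega
end

section
/- Let t₁ ≥ 1, t₂ and l₂ be natural numbers with (l₂, t₂) ≠ (0, 0) and (l₂ : ℤ) − t₂ ≠ 1, and let d be the greatest common divisor in ℤ of t₁, t₂ and l₂ − 1. Then the quotient of the abelian group ℤ² by the subgroup generated by the elements (t₁, t₁) and (t₂, l₂ − 1) of ℤ² is isomorphic, as an abelian group, to (ℤ/dℤ) × (ℤ/eℤ), where e = |t₁·(l₂ − 1 − t₂)| / d (an exact division in ℤ). -/
/-- If no prime divides all of `a`, `b` and `m`, with `m ≠ 0`, then some `k * a + b` is coprime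
to `m`. -/
theorem exists_isCoprime_mul_add {a b m : ℤ} (hm : m ≠ 0)
    (habm : ∀ q : ℕ, q.Prime → (q : ℤ) ∣ a → (q : ℤ) ∣ b → ¬ (q : ℤ) ∣ m) :
    ∃ k : ℤ, IsCoprime (k * a + b) m := by
  classical
  let s : Finset ℕ := m.natAbs.primeFactors.filter fun q : ℕ => ¬ (q : ℤ) ∣ b
  refine ⟨((∏ q ∈ s, q : ℕ) : ℤ), ?_⟩
  rw [Int.isCoprime_iff_gcd_eq_one]
  by_contra hne
  obtain ⟨q, hq, hqg⟩ := Nat.exists_prime_and_dvd hne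
  have hqI : Prime (q : ℤ) := Nat.prime_iff_prime_int.mp hq
  have hqg' : (q : ℤ) ∣ (Int.gcd (((∏ q ∈ s, q : ℕ) : ℤ) * a + b) m : ℤ) := by
    exact_mod_cast hqg
  have hqm : (q : ℤ) ∣ m := hqg'.trans (Int.gcd_dvd_right _ _)
  have hqk : (q : ℤ) ∣ ((∏ q ∈ s, q : ℕ) : ℤ) * a + b := hqg'.trans (Int.gcd_dvd_left _ _)
  by_cases hqb : (q : ℤ) ∣ b
  · rcases hqI.dvd_or_dvd ((dvd_add_left hqb).mp hqk) with hk | ha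
    · rw [Int.natCast_dvd_natCast, hq.prime.dvd_finsetProd_iff] at hk
      obtain ⟨r, hr, hqr⟩ := hk
      simp only [s, Finset.mem_filter, Nat.mem_primeFactors] at hr
      obtain rfl := (Nat.prime_dvd_prime_iff_eq hq hr.1.1).mp hqr
      exact hr.2 hqb
    · exact habm q hq ha hqb hqm
  · have hqs : q ∈ s := by
      simp only [s, Finset.mem_filter, Nat.mem_primeFactors]
      exact ⟨⟨hq, Int.natCast_dvd.mp hqm, by simpa using hm⟩, hqb⟩
    have hk : (q : ℤ) ∣ ((∏ q ∈ s, q : ℕ) : ℤ) :=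
      Int.natCast_dvd_natCast.mpr (Finset.dvd_prod_of_mem _ hqs)
    exact hqb ((dvd_add_right (hk.mul_right a)).mp hqk)

/-- The quotient of `ℤ²` by the span of `g • (a, a)` and `g • (b, b + m)`, where no prime divides
all of `a`, `b` and `m`. -/
theorem nonempty_quotient_closure_addEquiv (g : ℕ) {a b m : ℤ} (hm : m ≠ 0)
    (habm : ∀ q : ℕ, q.Prime → (q : ℤ) ∣ a → (q : ℤ) ∣ b → ¬ (q : ℤ) ∣ m) :
    Nonempty (((ℤ × ℤ) ⧸
        AddSubgroup.closure {((g : ℤ) * a, (g : ℤ) * a), ((g : ℤ) * b, (g : ℤ) * (b + m))}) ≃+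
      (ZMod g × ZMod (g * (a * m).natAbs))) := by
  obtain ⟨k, u, v, huv⟩ := exists_isCoprime_mul_add hm habm
  let F : ℤ × ℤ →+ ZMod g × ZMod (g * (a * m).natAbs) :=
    { toFun := fun z => (((u * z.1 + v * (z.2 - z.1) : ℤ) : ZMod g),
        ((-m * z.1 + (k * a + b) * (z.2 - z.1) : ℤ) : ZMod (g * (a * m).natAbs)))
      map_zero' := by simp
      map_add' := fun x y => by
        ext <;> simp only [Prod.fst_add, Prod.snd_add] <;> push_cast <;> ring }
  have hF : Function.Surjective F := by
    rintro ⟨x, y⟩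
    obtain ⟨x, rfl⟩ := ZMod.intCast_surjective x
    obtain ⟨y, rfl⟩ := ZMod.intCast_surjective y
    refine ⟨((k * a + b) * x - v * y, (k * a + b) * x - v * y + (m * x + u * y)), ?_⟩
    exact Prod.ext (congrArg (Int.cast : ℤ → ZMod g) (by linear_combination x * huv))
      (congrArg (Int.cast : ℤ → ZMod (g * (a * m).natAbs)) (by linear_combination y * huv))
  have hmem (z : ℤ × ℤ) : z ∈ F.ker ↔ (g : ℤ) ∣ u * z.1 + v * (z.2 - z.1) ∧
      (g : ℤ) * (a * m) ∣ -m * z.1 + (k * a + b) * (z.2 - z.1) := by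
    have : (g : ℤ) * (a * m) ∣ -m * z.1 + (k * a + b) * (z.2 - z.1) ↔
        ((g * (a * m).natAbs : ℕ) : ℤ) ∣ -m * z.1 + (k * a + b) * (z.2 - z.1) := by
      rw [← Int.natAbs_dvd, Int.natAbs_mul, Int.natAbs_natCast]
    rw [this, ← ZMod.intCast_zmod_eq_zero_iff_dvd, ← ZMod.intCast_zmod_eq_zero_iff_dvd,
      AddMonoidHom.mem_ker, Prod.ext_iff]
    rfl
  have hker : AddSubgroup.closure
      {((g : ℤ) * a, (g : ℤ) * a), ((g : ℤ) * b, (g : ℤ) * (b + m))} = F.ker := by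
    apply le_antisymm
    · rw [AddSubgroup.closure_le]
      rintro z (rfl | rfl)
      · exact (hmem _).mpr ⟨⟨u * a, by ring⟩, ⟨-1, by ring⟩⟩
      · exact (hmem _).mpr ⟨⟨u * b + v * m, by ring⟩, ⟨k, by ring⟩⟩
    · rintro ⟨x, y⟩ hz
      obtain ⟨⟨s, hs⟩, r, hr⟩ := (hmem _).mp hz
      rw [AddSubgroup.mem_closure_pair]
      refine ⟨k * s - v * m * r - b * u * r, s + u * a * r, ?_⟩
      simp only at hs hr
      have hx : x = (k * a + b) * (g * s) - v * (g * (a * m) * r) := by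
        linear_combination (k * a + b) * hs - v * hr - x * huv
      have hy : y - x = m * (g * s) + u * (g * (a * m) * r) := by
        linear_combination m * hs + u * hr - (y - x) * huv
      ext
      · simp only [Prod.fst_add, Prod.smul_fst, smul_eq_mul]
        linear_combination -hx
      · simp only [Prod.snd_add, Prod.smul_snd, smul_eq_mul]
        linear_combination -hx - hy
  exact ⟨(QuotientAddGroup.quotientAddEquivOfEq hker).trans
    (QuotientAddGroup.quotientKerEquivOfSurjective F hF)⟩


/-- Case IV: for `t₁ ≥ 1`, `(l₂, t₂) ≠ (0, 0)` and `l₂ - t₂ ≠ 1`, with `d` the gcd of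
`t₁`, `t₂` and `l₂ - 1`, the quotient of `ℤ²` by the subgroup generated by `(t₁, t₁)`
and `(t₂, l₂ - 1)` is isomorphic to `ℤ/dℤ × ℤ/eℤ`, where `e = |t₁ (l₂ - 1 - t₂)| / d`
(an exact division). -/
theorem stmt_12 (t₁ t₂ l₂ : ℕ) (h1 : 1 ≤ t₁) (h0 : (l₂, t₂) ≠ (0, 0))
    (h : (l₂ : ℤ) - t₂ ≠ 1) (d : ℕ)
    (hd : d = Int.gcd (Int.gcd (t₁ : ℤ) (t₂ : ℤ)) ((l₂ : ℤ) - 1)) :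
    Nonempty (((ℤ × ℤ) ⧸
        AddSubgroup.closure {((t₁ : ℤ), (t₁ : ℤ)), ((t₂ : ℤ), (l₂ : ℤ) - 1)}) ≃+
      (ZMod d × ZMod (((t₁ : ℤ) * ((l₂ : ℤ) - 1 - t₂)).natAbs / d))) := by
  have hd0 : d ≠ 0 := by
    rintro rfl
    have := (Int.gcd_eq_zero_iff.mp hd.symm).1
    rw [Int.natCast_eq_zero, Int.gcd_eq_zero_iff] at this
    omega
  have hdI : (d : ℤ) ≠ 0 := by exact_mod_cast hd0
  have hdd : (d : ℤ) ∣ (Int.gcd (t₁ : ℤ) (t₂ : ℤ) : ℤ) := hd ▸ Int.gcd_dvd_left _ _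
  obtain ⟨a, ha⟩ := hdd.trans (Int.gcd_dvd_left _ _)
  obtain ⟨b, hb⟩ := hdd.trans (Int.gcd_dvd_right _ _)
  obtain ⟨c, hc⟩ : (d : ℤ) ∣ (l₂ : ℤ) - 1 := hd ▸ Int.gcd_dvd_right _ _
  have hm : c - b ≠ 0 := by
    intro hcb
    apply h
    linear_combination hc - hb + d * hcb
  have hcop : ∀ q : ℕ, q.Prime → (q : ℤ) ∣ a → (q : ℤ) ∣ b → ¬ (q : ℤ) ∣ c - b := by
    intro q hq hqa hqb hqm
    have hqc : (q : ℤ) ∣ c := (dvd_sub_left hqb).mp hqm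
    have hdq : (d : ℤ) * q ∣ d := by
      conv_rhs => rw [hd]
      refine Int.dvd_coe_gcd (Int.dvd_coe_gcd ?_ ?_) ?_
      · exact ha ▸ mul_dvd_mul_left _ hqa
      · exact hb ▸ mul_dvd_mul_left _ hqb
      · exact hc ▸ mul_dvd_mul_left _ hqc
    have hdq' : d * q ∣ d * 1 := by rw [mul_one]; exact_mod_cast hdq
    exact hq.one_lt.ne' (Nat.dvd_one.mp (Nat.dvd_of_mul_dvd_mul_left (Nat.pos_of_ne_zero hd0) hdq'))
  have he : ((t₁ : ℤ) * ((l₂ : ℤ) - 1 - t₂)).natAbs / d = d * (a * (c - b)).natAbs := by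
    have : (t₁ : ℤ) * ((l₂ : ℤ) - 1 - t₂) = d * (d * (a * (c - b))) := by
      rw [ha, hb, hc]; ring
    rw [this, Int.natAbs_mul, Int.natAbs_mul, Int.natAbs_natCast,
      Nat.mul_div_cancel_left _ (Nat.pos_of_ne_zero hd0)]
  have key := nonempty_quotient_closure_addEquiv d hm hcop
  rwa [add_sub_cancel, ← ha, ← hb, ← hc, ← he] at key
end
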